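/- Let C be an [lm, K] quasi-cyclic code over F_q which is a linear code over R_m ε_t, where the primitive idempotent ε_t corresponds to the q-cyclotomic coset {i_t, i_t q, …, i_t q^{k−1}} modulo m. Let ξ be a primitive element of F_q, let r be a positive divisor of q−1, and consider the induced action of the scalar multiplications on the set ⟨ρ^l⟩\C* of ⟨ρ^l⟩-orbits on C* = C \ {0}. Then the number of ⟨ρ^l⟩-orbits O satisfying ξ^r·O = O is equal to gcd(m, i_t)·(q^K − 1)/m if (q−1)/r divides m/gcd(m, i_t), and is equal to 0 otherwise. -/

import Mathlib

open scoped Pointwise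

/-- The shift `ρ^l` on `F^{lm}`, with a codeword indexed as `c (i, j) = c_{ij}`
(`i ∈ ZMod m` the block index, `j ∈ Fin l` the position inside a block):
`(ρ^l c) (i, j) = c (i - 1, j)`. -/
noncomputable def shiftQC (F : Type*) [Field F] (m l : ℕ) :
    ((ZMod m × Fin l) → F) ≃ₗ[F] ((ZMod m × Fin l) → F) :=
  LinearEquiv.funCongrLeft F F ((Equiv.subRight (1 : ZMod m)).prodCongr (Equiv.refl (Fin l)))

/-- The `q`-cyclotomic coset of `i_t` modulo `m`, viewed inside `ZMod m`. -/
def cycCoset (q m it : ℕ) : Set (ZMod m) :=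
  {j | ∃ r : ℕ, j = (it : ZMod m) * (q : ZMod m) ^ r}

/-- Evaluation of the polynomial `Σ_i c_i x^i ∈ R_m = F[x]/(x^m - 1)` at `ζ^j`, computed in
an extension field `E` of `F` containing the primitive `m`-th root of unity `ζ`. -/
noncomputable def evalDFT {F E : Type*} [Field F] [Field E] [Algebra F E] {m : ℕ} [NeZero m]
    (ζ : E) (c : ZMod m → F) (j : ZMod m) : E :=
  ∑ i : ZMod m, algebraMap F E (c i) * ζ ^ (i * j).val

/-- `Σ_i c_i x^i` lies in the minimal ideal `R_m ε_t` of `R_m` associated with the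
`q`-cyclotomic coset of `i_t`, i.e. it vanishes at `ζ^j` for every `j` outside the coset. -/
def inMinIdeal {F E : Type*} [Field F] [Field E] [Algebra F E] (q : ℕ) {m : ℕ} [NeZero m]
    (ζ : E) (it : ℕ) (c : ZMod m → F) : Prop :=
  ∀ j : ZMod m, j ∉ cycCoset q m it → evalDFT ζ c j = 0

theorem Set.ncard_image_mul_of_fiber_ncard {α β : Type*} {S : Set α} (hS : S.Finite) (f : α → β)
    (n : ℕ) (h : ∀ c ∈ S, {x | x ∈ S ∧ f x = f c}.ncard = n) :
    (f '' S).ncard * n = S.ncard := by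
  classical
  obtain ⟨s, rfl⟩ := hS.exists_finset_coe
  rw [← Finset.coe_image, Set.ncard_coe_finset, Set.ncard_coe_finset,
    Finset.card_eq_sum_card_image f s, Finset.sum_const_nat]
  intro b hb
  obtain ⟨c, hc, rfl⟩ := Finset.mem_image.mp hb
  rw [← h c hc, ← Set.ncard_coe_finset]
  congr 1
  ext x
  simp

theorem IsPrimitiveRoot.pow_val_natCast {E : Type*} [Field E] {m : ℕ} {ζ : E}
    (hζ : IsPrimitiveRoot ζ m) (a : ℕ) :
    ζ ^ (a : ZMod m).val = ζ ^ a := by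
  rw [ZMod.val_natCast, hζ.eq_orderOf, pow_mod_orderOf]

section RootCharacter

variable {E : Type*} [Field E] {m : ℕ} [NeZero m] {ζ : E}

theorem IsPrimitiveRoot.pow_val_add (hζ : IsPrimitiveRoot ζ m) (a b : ZMod m) :
    ζ ^ (a + b).val = ζ ^ a.val * ζ ^ b.val := by
  rw [← pow_add, ← hζ.pow_val_natCast (a.val + b.val)]
  simp

theorem IsPrimitiveRoot.pow_val_mul_natCast (hζ : IsPrimitiveRoot ζ m) (a : ZMod m) (k : ℕ) :
    ζ ^ (a * k).val = (ζ ^ a.val) ^ k := by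
  rw [← pow_mul, ← hζ.pow_val_natCast (a.val * k)]
  simp

theorem IsPrimitiveRoot.pow_val_mul (hζ : IsPrimitiveRoot ζ m) (a b : ZMod m) :
    ζ ^ (a * b).val = (ζ ^ b.val) ^ a.val := by
  rw [← hζ.pow_val_mul_natCast, ZMod.natCast_zmod_val, mul_comm]

theorem IsPrimitiveRoot.pow_val_eq_one_iff (hζ : IsPrimitiveRoot ζ m) (a : ZMod m) :
    ζ ^ a.val = 1 ↔ a = 0 := by
  rw [hζ.pow_eq_one_iff_dvd, ← ZMod.natCast_eq_zero_iff]
  simp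

theorem ZMod.natCast_mul_eq_zero_iff_div_gcd_dvd (it a : ℕ) :
    (a : ZMod m) * it = 0 ↔ m / Nat.gcd m it ∣ a := by
  have hm : 0 < m := Nat.pos_of_ne_zero (NeZero.ne m)
  have hg : 0 < Nat.gcd m it := Nat.gcd_pos_of_pos_left _ hm
  rw [← Nat.cast_mul, ZMod.natCast_eq_zero_iff]
  constructor
  · intro h
    refine (Nat.coprime_div_gcd_div_gcd hg).dvd_of_dvd_mul_right ?_
    rw [← Nat.mul_div_assoc _ (Nat.gcd_dvd_right m it)]
    exact Nat.div_dvd_div (Nat.gcd_dvd_left m it) h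
  · rintro ⟨b, rfl⟩
    obtain ⟨e, he⟩ := Nat.gcd_dvd_right m it
    refine ⟨b * e, ?_⟩
    calc m / Nat.gcd m it * b * it = m / Nat.gcd m it * b * (Nat.gcd m it * e) := by rw [← he]
      _ = m / Nat.gcd m it * Nat.gcd m it * (b * e) := by ring
      _ = m * (b * e) := by rw [Nat.div_mul_cancel (Nat.gcd_dvd_left m it)]

theorem ZMod.intCast_mul_eq_zero_iff_div_gcd_dvd (it : ℕ) (z : ℤ) :
    (z : ZMod m) * it = 0 ↔ ((m / Nat.gcd m it : ℕ) : ℤ) ∣ z := by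
  obtain ⟨a, rfl | rfl⟩ := z.eq_nat_or_neg
  · rw [Int.natCast_dvd_natCast, ← ZMod.natCast_mul_eq_zero_iff_div_gcd_dvd, Int.cast_natCast]
  · rw [dvd_neg, Int.natCast_dvd_natCast, ← ZMod.natCast_mul_eq_zero_iff_div_gcd_dvd,
      Int.cast_neg, Int.cast_natCast, neg_mul, neg_eq_zero]

theorem ZMod.intCast_mul_mem_cycCoset_eq_zero_iff {q it : ℕ} (hco : Nat.Coprime m q)
    {j : ZMod m} (hj : j ∈ cycCoset q m it) (z : ℤ) :
    (z : ZMod m) * j = 0 ↔ ((m / Nat.gcd m it : ℕ) : ℤ) ∣ z := by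
  obtain ⟨s, rfl⟩ := hj
  have hu : IsUnit ((q : ZMod m) ^ s) := ((ZMod.isUnit_iff_coprime q m).mpr hco.symm).pow s
  rw [← mul_assoc, hu.mul_left_eq_zero, ZMod.intCast_mul_eq_zero_iff_div_gcd_dvd]

theorem IsPrimitiveRoot.pow_div_gcd (hζ : IsPrimitiveRoot ζ m) (it : ℕ) :
    IsPrimitiveRoot (ζ ^ it) (m / Nat.gcd m it) := by
  have key (a : ℕ) : (ζ ^ it) ^ a = 1 ↔ m / Nat.gcd m it ∣ a := by
    rw [← hζ.pow_val_natCast it, ← hζ.pow_val_mul_natCast, hζ.pow_val_eq_one_iff, mul_comm,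
      ZMod.natCast_mul_eq_zero_iff_div_gcd_dvd]
  exact ⟨(key _).mpr dvd_rfl, fun a ha => (key a).mp ha⟩

variable {F : Type*} [Field F] [Algebra F E]

theorem eq_zero_of_evalDFT_eq_zero (hζ : IsPrimitiveRoot ζ m) (c : ZMod m → F)
    (h : ∀ j, evalDFT ζ c j = 0) : c = 0 := by
  have hm := NeZero.ne m
  obtain _ | n := m
  · exact absurd rfl hm
  have hinj : Function.Injective (fun j : Fin (n + 1) => ζ ^ (j : ℕ)) := fun a b hab =>
    Fin.ext (hζ.pow_inj a.2 b.2 hab)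
  have hz := Matrix.eq_zero_of_forall_index_sum_mul_pow_eq_zero
    (v := fun i => algebraMap F E (c i)) hinj (fun j => by
    refine Eq.trans ?_ (h j)
    refine Finset.sum_congr rfl fun i _ => ?_
    congr 1
    exact (hζ.pow_val_mul i j).symm)
  funext i
  exact (algebraMap F E).injective ((congrFun hz i).trans (map_zero _).symm)

theorem evalDFT_smul (a : F) (c : ZMod m → F) (j : ZMod m) :
    evalDFT ζ (a • c) j = algebraMap F E a * evalDFT ζ c j := by
  simp [evalDFT, Finset.mul_sum, mul_assoc]

theorem evalDFT_sub (c d : ZMod m → F) (j : ZMod m) :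
    evalDFT ζ (c - d) j = evalDFT ζ c j - evalDFT ζ d j := by
  simp [evalDFT, sub_mul]

theorem evalDFT_translate (hζ : IsPrimitiveRoot ζ m) (c : ZMod m → F) (z j : ZMod m) :
    evalDFT ζ (fun i => c (i - z)) j = ζ ^ (z * j).val * evalDFT ζ c j := by
  unfold evalDFT
  rw [← Equiv.sum_comp (Equiv.addRight z), Finset.mul_sum]
  refine Finset.sum_congr rfl fun i _ => ?_
  simp only [Equiv.coe_addRight, add_sub_cancel_right, add_mul, hζ.pow_val_add]
  ring

end RootCharacter

section Shift

variable {F : Type*} [Field F] {m l : ℕ}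

theorem shiftQC_pow_apply (c : ZMod m × Fin l → F) (a : ℕ) (i : ZMod m) (v : Fin l) :
    (shiftQC F m l ^ a) c (i, v) = c (i - a, v) := by
  induction a generalizing i with
  | zero => simp
  | succ a ih =>
    rw [pow_succ', LinearEquiv.mul_apply]
    change (shiftQC F m l ^ a) c (i - 1, v) = _
    rw [ih]
    congr 2
    push_cast
    ring

theorem shiftQC_zpow_apply (c : ZMod m × Fin l → F) (z : ℤ) (i : ZMod m) (v : Fin l) :
    (shiftQC F m l ^ z) c (i, v) = c (i - z, v) := by
  obtain ⟨a, rfl | rfl⟩ := z.eq_nat_or_neg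
  · simpa using shiftQC_pow_apply c a i v
  · have h := shiftQC_pow_apply ((shiftQC F m l ^ (-(a : ℤ))) c) a (i + a) v
    rw [← zpow_natCast, ← LinearEquiv.mul_apply, ← zpow_add, add_neg_cancel, zpow_zero,
      add_sub_cancel_right] at h
    rw [← h]
    simp

theorem setOf_shiftQC_zpow_eq_iff (c d : ZMod m × Fin l → F) :
    {x | ∃ z : ℤ, (shiftQC F m l ^ z) d = x} = {x | ∃ z : ℤ, (shiftQC F m l ^ z) c = x} ↔
      ∃ z : ℤ, (shiftQC F m l ^ z) c = d := by
  constructor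
  · intro h
    have hd : d ∈ {x | ∃ z : ℤ, (shiftQC F m l ^ z) d = x} := ⟨0, by simp⟩
    rwa [h] at hd
  · rintro ⟨y, rfl⟩
    ext x
    constructor
    · rintro ⟨z, rfl⟩
      exact ⟨z + y, by rw [zpow_add, LinearEquiv.mul_apply]⟩
    · rintro ⟨z, rfl⟩
      exact ⟨z - y, by rw [← LinearEquiv.mul_apply, ← zpow_add, sub_add_cancel]⟩

theorem smul_setOf_shiftQC_zpow (a : F) (c : ZMod m × Fin l → F) :
    a • {x | ∃ z : ℤ, (shiftQC F m l ^ z) c = x} =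
      {x | ∃ z : ℤ, (shiftQC F m l ^ z) (a • c) = x} := by
  ext x
  simp only [Set.mem_smul_set, Set.mem_ofPred_eq, map_smul]
  constructor
  · rintro ⟨_, ⟨z, rfl⟩, rfl⟩
    exact ⟨z, rfl⟩
  · rintro ⟨z, rfl⟩
    exact ⟨_, ⟨z, rfl⟩, rfl⟩

theorem ncard_setOf_shiftQC_zpow {c : ZMod m × Fin l → F} (n : ℕ) (hn : 0 < n)
    (h : ∀ z : ℤ, (shiftQC F m l ^ z) c = c ↔ (n : ℤ) ∣ z) :
    {x | ∃ z : ℤ, (shiftQC F m l ^ z) c = x}.ncard = n := by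
  have heq (y z : ℤ) : (shiftQC F m l ^ y) c = (shiftQC F m l ^ z) c ↔ (n : ℤ) ∣ z - y := by
    rw [← h, ← (shiftQC F m l ^ y).injective.eq_iff (b := c), ← LinearEquiv.mul_apply,
      ← zpow_add, add_sub_cancel, eq_comm]
  have himg : {x | ∃ z : ℤ, (shiftQC F m l ^ z) c = x} =
      (fun a : ℕ => (shiftQC F m l ^ (a : ℤ)) c) '' (Finset.range n : Set ℕ) := by
    have hn' : (0 : ℤ) < n := by exact_mod_cast hn
    ext x
    constructor
    · rintro ⟨z, rfl⟩
      have h0 := Int.emod_nonneg z hn'.ne'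
      have h1 := Int.emod_lt_of_pos z hn'
      refine ⟨(z % n).toNat, ?_, ?_⟩
      · rw [Finset.mem_coe, Finset.mem_range]
        omega
      · dsimp only
        rw [heq, Int.toNat_of_nonneg h0]
        exact Int.dvd_self_sub_emod
    · rintro ⟨a, -, rfl⟩
      exact ⟨a, rfl⟩
  have hinj : Set.InjOn (fun a : ℕ => (shiftQC F m l ^ (a : ℤ)) c) (Finset.range n : Set ℕ) := by
    intro a ha b hb hab
    rw [Finset.mem_coe, Finset.mem_range] at ha hb
    have hmod := Int.modEq_iff_dvd.mpr ((heq a b).mp hab)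
    exact (Int.natCast_modEq_iff.mp hmod).eq_of_lt_of_lt ha hb
  rw [himg, hinj.ncard_image, Set.ncard_coe_finset, Finset.card_range]

variable {E : Type*} [Field E] [Algebra F E] [NeZero m] {ζ : E}

theorem shiftQC_zpow_mem {C : Submodule F (ZMod m × Fin l → F)}
    (hQC : ∀ c ∈ C, shiftQC F m l c ∈ C) {c : ZMod m × Fin l → F} (hc : c ∈ C) (z : ℤ) :
    (shiftQC F m l ^ z) c ∈ C := by
  have hpow (a : ℕ) : (shiftQC F m l ^ a) c ∈ C := by
    induction a with
    | zero => simpa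
    | succ a ih => rw [pow_succ', LinearEquiv.mul_apply]; exact hQC _ ih
  convert hpow (z : ZMod m).val using 1
  funext ⟨i, v⟩
  rw [shiftQC_zpow_apply, shiftQC_pow_apply, ZMod.natCast_zmod_val]

theorem evalDFT_shiftQC_zpow (hζ : IsPrimitiveRoot ζ m) (c : ZMod m × Fin l → F) (z : ℤ)
    (v : Fin l) (j : ZMod m) :
    evalDFT ζ (fun i => (shiftQC F m l ^ z) c (i, v)) j =
      ζ ^ ((z : ZMod m) * j).val * evalDFT ζ (fun i => c (i, v)) j := by
  simp only [shiftQC_zpow_apply]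
  exact evalDFT_translate hζ (fun i => c (i, v)) z j

variable {q it : ℕ} {c : ZMod m × Fin l → F}

theorem shiftQC_zpow_eq_smul_iff (hζ : IsPrimitiveRoot ζ m)
    (hc : ∀ v, inMinIdeal q ζ it (fun i => c (i, v))) (z : ℤ) (a : F) :
    (shiftQC F m l ^ z) c = a • c ↔ ∀ j ∈ cycCoset q m it,
      ∀ v, evalDFT ζ (fun i => c (i, v)) j ≠ 0 → ζ ^ ((z : ZMod m) * j).val = algebraMap F E a := by
  constructor
  · intro h j _ v hv
    have h1 := evalDFT_shiftQC_zpow hζ c z v j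
    rw [h] at h1
    have h2 := evalDFT_smul (ζ := ζ) a (fun i => c (i, v)) j
    exact mul_right_cancel₀ hv (h1.symm.trans h2)
  · intro h
    funext ⟨i, v⟩
    have h0 : (fun i => (shiftQC F m l ^ z) c (i, v)) - a • (fun i => c (i, v)) = 0 := by
      refine eq_zero_of_evalDFT_eq_zero hζ _ fun j => ?_
      rw [evalDFT_sub, evalDFT_smul, evalDFT_shiftQC_zpow hζ, ← sub_mul]
      by_cases hv : evalDFT ζ (fun i => c (i, v)) j = 0
      · rw [hv, mul_zero]
      · have hj : j ∈ cycCoset q m it := by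
          by_contra hj
          exact hv (hc v j hj)
        rw [h j hj v hv, sub_self, zero_mul]
    exact sub_eq_zero.mp (congrFun h0 i)

theorem exists_evalDFT_ne_zero (hζ : IsPrimitiveRoot ζ m)
    (hc : ∀ v, inMinIdeal q ζ it (fun i => c (i, v))) (hc0 : c ≠ 0) :
    ∃ j ∈ cycCoset q m it, ∃ v, evalDFT ζ (fun i => c (i, v)) j ≠ 0 := by
  by_contra! h
  refine hc0 (funext fun ⟨i, v⟩ => ?_)
  refine congrFun (eq_zero_of_evalDFT_eq_zero hζ (fun i => c (i, v)) fun j => ?_) i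
  by_cases hj : j ∈ cycCoset q m it
  · exact h j hj v
  · exact hc v j hj

theorem shiftQC_zpow_eq_self_iff (hζ : IsPrimitiveRoot ζ m) (hco : Nat.Coprime m q)
    (hc : ∀ v, inMinIdeal q ζ it (fun i => c (i, v))) (hc0 : c ≠ 0) (z : ℤ) :
    (shiftQC F m l ^ z) c = c ↔ ((m / Nat.gcd m it : ℕ) : ℤ) ∣ z := by
  have h := shiftQC_zpow_eq_smul_iff hζ hc z 1
  rw [one_smul] at h
  simp only [map_one, hζ.pow_val_eq_one_iff] at h
  rw [h]
  constructor
  · intro h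
    obtain ⟨j, hj, v, hv⟩ := exists_evalDFT_ne_zero hζ hc hc0
    exact (ZMod.intCast_mul_mem_cycCoset_eq_zero_iff hco hj z).mp (h j hj v hv)
  · intro h j hj _ _
    exact (ZMod.intCast_mul_mem_cycCoset_eq_zero_iff hco hj z).mpr h

theorem exists_shiftQC_zpow_eq_smul_iff [Fintype F] (hζ : IsPrimitiveRoot ζ m)
    (hco : Nat.Coprime m (Fintype.card F))
    (hc : ∀ v, inMinIdeal (Fintype.card F) ζ it (fun i => c (i, v))) (hc0 : c ≠ 0) (a : F) :
    (∃ z : ℤ, (shiftQC F m l ^ z) c = a • c) ↔ a ^ (m / Nat.gcd m it) = 1 := by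
  have hm : 0 < m := Nat.pos_of_ne_zero (NeZero.ne m)
  have hn : NeZero (m / Nat.gcd m it) :=
    ⟨(Nat.div_pos (Nat.gcd_le_left _ hm) (Nat.gcd_pos_of_pos_left _ hm)).ne'⟩
  constructor
  · rintro ⟨z, hz⟩
    obtain ⟨j, hj, v, hv⟩ := exists_evalDFT_ne_zero hζ hc hc0
    have h := (shiftQC_zpow_eq_smul_iff hζ hc z a).mp hz j hj v hv
    apply (algebraMap F E).injective
    rw [map_pow, ← h, ← hζ.pow_val_mul_natCast, map_one, hζ.pow_val_eq_one_iff]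
    have := (ZMod.intCast_mul_mem_cycCoset_eq_zero_iff hco hj
      (z * (m / Nat.gcd m it : ℕ))).mpr (dvd_mul_left _ _)
    rw [← this, Int.cast_mul, Int.cast_natCast]
    ring
  · intro ha
    obtain ⟨b, -, hb⟩ := (hζ.pow_div_gcd it).eq_pow_of_pow_eq_one
      (ξ := algebraMap F E a) (by rw [← map_pow, ha, map_one])
    refine ⟨b, (shiftQC_zpow_eq_smul_iff hζ hc b a).mpr ?_⟩
    rintro _ ⟨s, rfl⟩ v -
    have h : ((b : ℤ) : ZMod m) * ((it : ZMod m) * (Fintype.card F : ZMod m) ^ s) =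
        ((it * b * Fintype.card F ^ s : ℕ) : ZMod m) := by
      push_cast
      ring
    rw [h, hζ.pow_val_natCast, pow_mul, pow_mul, hb, ← map_pow, FiniteField.pow_card_pow]

end Shift

theorem Submodule.ncard_diff_zero {F V : Type*} [Field F] [Fintype F] [AddCommGroup V]
    [Module F V] [Finite V] (C : Submodule F V) :
    {c : V | c ∈ C ∧ c ≠ 0}.ncard = Fintype.card F ^ Module.finrank F C - 1 := by
  have h1 : {c : V | c ∈ C ∧ c ≠ 0} = (C : Set V) \ {0} := by
    ext
    simp
  have h2 : (C : Set V).ncard = Nat.card C := rfl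
  rw [h1, Set.ncard_sdiff_singleton_of_mem C.zero_mem, h2,
    Module.natCard_eq_pow_finrank (K := F), Nat.card_eq_fintype_card]

/-- Let `C` be an `[lm, K]` quasi-cyclic code over `F_q` which is a linear
code over `R_m ε_t`, `ξ` a primitive element of `F_q` and `r` a positive divisor of `q - 1`.
For the induced action of scalar multiplication on the set of `⟨ρ^l⟩`-orbits of `C \ {0}`,
the number of orbits `O` with `ξ^r • O = O` equals `gcd(m, i_t)(q^K - 1)/m` if
`(q-1)/r ∣ m / gcd(m, i_t)`, and `0` otherwise. -/
theorem scalar_fixed_shift_orbits {F E : Type*} [Field F] [Fintype F] [DecidableEq F]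
    [Field E] [Algebra F E] {m l K k it : ℕ} [NeZero m] (hl : 2 ≤ l)
    (hco : Nat.Coprime m (Fintype.card F))
    (ζ : E) (hζ : IsPrimitiveRoot ζ m)
    (C : Submodule F ((ZMod m × Fin l) → F))
    (hQC : ∀ c ∈ C, shiftQC F m l c ∈ C)
    (hmin : ∀ c ∈ C, ∀ v : Fin l,
      inMinIdeal (Fintype.card F) ζ it (fun i : ZMod m => c (i, v)))
    (hK : Module.finrank F ↥C = K)
    (hk : (cycCoset (Fintype.card F) m it).ncard = k)
    (ξ : Fˣ) (hξ : ∀ x : Fˣ, x ∈ Subgroup.zpowers ξ)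
    {r : ℕ} (hr : r ∣ Fintype.card F - 1) (hrpos : 0 < r) :
    (Set.ncard {O : Set ((ZMod m × Fin l) → F) |
        (∃ c, c ∈ C ∧ c ≠ 0 ∧ O = {x | ∃ z : ℤ, (shiftQC F m l ^ z) c = x}) ∧
        ((ξ : F) ^ r) • O = O} : ℚ) =
      if ((Fintype.card F - 1) / r) ∣ (m / Nat.gcd m it) then
        (Nat.gcd m it * (Fintype.card F ^ K - 1) : ℕ) / (m : ℚ)
      else 0 := by
  classical
  set n := m / Nat.gcd m it with hn_def
  have hm : 0 < m := Nat.pos_of_ne_zero (NeZero.ne m)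
  have hg : 0 < Nat.gcd m it := Nat.gcd_pos_of_pos_left _ hm
  have hn : 0 < n := Nat.div_pos (Nat.gcd_le_left _ hm) hg
  have hgn : Nat.gcd m it * n = m := Nat.mul_div_cancel' (Nat.gcd_dvd_left m it)
  have hord : orderOf ((ξ : F) ^ r) = (Fintype.card F - 1) / r := by
    have hξo : orderOf ξ = Fintype.card F - 1 := by
      rw [orderOf_eq_card_of_forall_mem_zpowers hξ, Nat.card_eq_fintype_card, Fintype.card_units]
    rw [← Units.val_pow_eq_pow_val, orderOf_units, orderOf_pow_of_dvd hrpos.ne' (hξo ▸ hr), hξo]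
  have hfix (c : ZMod m × Fin l → F) (hc : c ∈ C) (hc0 : c ≠ 0) :
      ((ξ : F) ^ r) • {x | ∃ z : ℤ, (shiftQC F m l ^ z) c = x} =
        {x | ∃ z : ℤ, (shiftQC F m l ^ z) c = x} ↔ (Fintype.card F - 1) / r ∣ n := by
    rw [smul_setOf_shiftQC_zpow, setOf_shiftQC_zpow_eq_iff,
      exists_shiftQC_zpow_eq_smul_iff hζ hco (hmin c hc) hc0, ← hord, orderOf_dvd_iff_pow_eq_one]
  split_ifs with hd
  · have hset : {O : Set ((ZMod m × Fin l) → F) |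
        (∃ c, c ∈ C ∧ c ≠ 0 ∧ O = {x | ∃ z : ℤ, (shiftQC F m l ^ z) c = x}) ∧
        ((ξ : F) ^ r) • O = O} =
        (fun c => {x | ∃ z : ℤ, (shiftQC F m l ^ z) c = x}) '' {c | c ∈ C ∧ c ≠ 0} := by
      ext O
      constructor
      · rintro ⟨⟨c, hc, hc0, rfl⟩, -⟩
        exact ⟨c, ⟨hc, hc0⟩, rfl⟩
      · rintro ⟨c, ⟨hc, hc0⟩, rfl⟩
        exact ⟨⟨c, hc, hc0, rfl⟩, (hfix c hc hc0).mpr hd⟩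
    have hcount := Set.ncard_image_mul_of_fiber_ncard (Set.toFinite {c | c ∈ C ∧ c ≠ 0})
      (fun c => {x | ∃ z : ℤ, (shiftQC F m l ^ z) c = x}) n (by
        rintro c ⟨hc, hc0⟩
        rw [← ncard_setOf_shiftQC_zpow n hn (shiftQC_zpow_eq_self_iff hζ hco (hmin c hc) hc0)]
        congr 1
        ext x
        simp only [Set.mem_ofPred_eq, setOf_shiftQC_zpow_eq_iff, and_iff_right_iff_imp]
        rintro ⟨z, rfl⟩
        exact ⟨shiftQC_zpow_mem hQC hc z, by simpa using hc0⟩)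
    rw [Submodule.ncard_diff_zero, hK] at hcount
    rw [hset, ← hcount, eq_div_iff (by exact_mod_cast hm.ne')]
    have hgn' : (m : ℚ) = Nat.gcd m it * n := by exact_mod_cast hgn.symm
    rw [hgn']
    push_cast
    ring
  · have hset : {O : Set ((ZMod m × Fin l) → F) |
        (∃ c, c ∈ C ∧ c ≠ 0 ∧ O = {x | ∃ z : ℤ, (shiftQC F m l ^ z) c = x}) ∧
        ((ξ : F) ^ r) • O = O} = ∅ := by
      ext O
      simp only [Set.mem_ofPred_eq, Set.mem_empty_iff_false, iff_false]
      rintro ⟨⟨c, hc, hc0, rfl⟩, h⟩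
      exact hd ((hfix c hc hc0).mp h)
    rw [hset, Set.ncard_empty, Nat.cast_zero]
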